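/- The following two statements are equivalent. (a) There is a constant C such that for every λ > 0, every toral eigenfunction f with eigenvalue λ² (i.e. f(x) = Σ_{ℓ ∈ ℤ², |ℓ| = λ} a_ℓ e^{i⟨x,ℓ⟩} with complex coefficients a_ℓ), every x₀ ∈ ℝ² and every unit vector v ∈ ℝ²: ∫_0^1 |f(x₀ + t v)|² dt ≤ C ∫_{[0,2π]²} |f(x)|² dx. (b) There is a constant B such that for every λ ≥ 1, every arc of the circle { x ∈ ℝ² : |x| = λ } of angular aperture λ^{−1/2} contains at most B points of ℤ². -/

import Mathlib

open MeasureTheory Real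

noncomputable section

lemma ofReal_norm_sq_sum_mul_exp {ι : Type*} (S : Finset ι) (c : ι → ℂ) (φ : ι → ℝ) :
    ((‖∑ j ∈ S, c j * Complex.exp ((φ j : ℂ) * Complex.I)‖ ^ 2 : ℝ) : ℂ) =
      ∑ j ∈ S, ∑ k ∈ S, c j * (starRingEnd ℂ) (c k) *
        Complex.exp (((φ j - φ k : ℝ) : ℂ) * Complex.I) := by
  rw [Complex.ofReal_pow, ← Complex.mul_conj', map_sum, Finset.sum_mul_sum]
  refine Finset.sum_congr rfl fun j _ => Finset.sum_congr rfl fun k _ => ?_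
  rw [map_mul, ← Complex.exp_conj, map_mul, Complex.conj_I, Complex.conj_ofReal,
    mul_mul_mul_comm, ← Complex.exp_add]
  congr 2
  push_cast
  ring

lemma integral_Icc_exp_int_mul_I (n : ℤ) :
    ∫ x in Set.Icc (0 : ℝ) (2 * π), Complex.exp (((x * n : ℝ) : ℂ) * Complex.I) =
      if n = 0 then ((2 * π : ℝ) : ℂ) else 0 := by
  rw [integral_Icc_eq_integral_Ioc, ← intervalIntegral.integral_of_le (by positivity)]
  split_ifs with hn
  · simp [hn]
  · have hc : (n : ℂ) * Complex.I ≠ 0 := by simp [hn]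
    have : ∀ x : ℝ, Complex.exp (((x * n : ℝ) : ℂ) * Complex.I) =
        Complex.exp (n * Complex.I * x) := fun x => by
      congr 1
      push_cast
      ring
    simp_rw [this]
    rw [integral_exp_mul_complex hc]
    have h : (n : ℂ) * Complex.I * ((2 * π : ℝ) : ℂ) = n * (2 * π * Complex.I) := by
      push_cast
      ring
    rw [h, Complex.exp_int_mul_two_pi_mul_I]
    simp

lemma integral_torus_exp_int_mul_I (m n : ℤ) :
    ∫ x in (Set.Icc (0 : ℝ) (2 * π)) ×ˢ (Set.Icc (0 : ℝ) (2 * π)),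
        Complex.exp (((x.1 * m + x.2 * n : ℝ) : ℂ) * Complex.I) =
      if m = 0 ∧ n = 0 then (((2 * π) ^ 2 : ℝ) : ℂ) else 0 := by
  have h := setIntegral_prod_mul (μ := (volume : Measure ℝ)) (ν := (volume : Measure ℝ))
    (fun x : ℝ => Complex.exp (((x * m : ℝ) : ℂ) * Complex.I))
    (fun x : ℝ => Complex.exp (((x * n : ℝ) : ℂ) * Complex.I))
    (Set.Icc (0 : ℝ) (2 * π)) (Set.Icc (0 : ℝ) (2 * π))
  rw [integral_Icc_exp_int_mul_I, integral_Icc_exp_int_mul_I, ← Measure.volume_eq_prod] at h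
  simp_rw [Complex.ofReal_add, add_mul, Complex.exp_add]
  rw [h]
  by_cases hm : m = 0 <;> by_cases hn : n = 0 <;> simp [hm, hn, sq]

/-- Parseval's identity for trigonometric polynomials on `[0, 2π]²`. -/
lemma integral_torus_norm_sq (S : Finset (ℤ × ℤ)) (a : ℤ × ℤ → ℂ) :
    ∫ x in (Set.Icc (0 : ℝ) (2 * π)) ×ˢ (Set.Icc (0 : ℝ) (2 * π)),
        ‖∑ ℓ ∈ S, a ℓ * Complex.exp (((x.1 * ℓ.1 + x.2 * ℓ.2 : ℝ) : ℂ) * Complex.I)‖ ^ 2 =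
      (2 * π) ^ 2 * ∑ ℓ ∈ S, ‖a ℓ‖ ^ 2 := by
  rw [← Complex.ofReal_inj, ← integral_complex_ofReal]
  simp_rw [ofReal_norm_sq_sum_mul_exp]
  have hK : IsCompact ((Set.Icc (0 : ℝ) (2 * π)) ×ˢ (Set.Icc (0 : ℝ) (2 * π))) :=
    isCompact_Icc.prod isCompact_Icc
  have hint : ∀ j k : ℤ × ℤ, IntegrableOn (fun x : ℝ × ℝ => a j * (starRingEnd ℂ) (a k) *
      Complex.exp (((x.1 * j.1 + x.2 * j.2 - (x.1 * k.1 + x.2 * k.2) : ℝ) : ℂ) * Complex.I))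
      ((Set.Icc (0 : ℝ) (2 * π)) ×ˢ (Set.Icc (0 : ℝ) (2 * π))) volume := fun j k =>
    ContinuousOn.integrableOn_compact hK (by fun_prop)
  rw [integral_finsetSum _ fun j _ => integrable_finsetSum _ fun k _ => hint j k]
  rw [Complex.ofReal_mul, Complex.ofReal_sum, Finset.mul_sum]
  refine Finset.sum_congr rfl fun j hj => ?_
  rw [integral_finsetSum _ fun k _ => hint j k, Finset.sum_eq_single_of_mem j hj]
  · simp only [sub_self, Complex.ofReal_zero, zero_mul, Complex.exp_zero, mul_one]
    rw [Complex.ofReal_pow ‖a j‖, ← Complex.mul_conj', setIntegral_const, Measure.volume_eq_prod,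
      measureReal_prod_prod]
    simp [Real.volume_real_Icc, Real.pi_nonneg, sq]
  · intro k _ hkj
    rw [integral_const_mul]
    have h := integral_torus_exp_int_mul_I (j.1 - k.1) (j.2 - k.2)
    rw [if_neg fun h => hkj (Prod.ext (by omega) (by omega))] at h
    rw [mul_eq_zero]
    right
    rw [← h]
    refine integral_congr_ae (Filter.Eventually.of_forall fun x => ?_)
    push_cast
    congr 1
    ring

lemma integral_gaussian_mul_exp (x : ℝ) :
    ∫ t : ℝ, ((rexp (-t ^ 2) : ℝ) : ℂ) * Complex.exp (((t * x : ℝ) : ℂ) * Complex.I) =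
      ((√π * rexp (-x ^ 2 / 4) : ℝ) : ℂ) := by
  have h := fourierIntegral_gaussian (b := 1) (by simp) (x : ℂ)
  have hpi : ((π : ℂ) / 1) ^ (1 / 2 : ℂ) = ((√π : ℝ) : ℂ) := by
    rw [div_one, Real.sqrt_eq_rpow, Complex.ofReal_cpow Real.pi_nonneg]
    norm_num
  rw [hpi] at h
  push_cast
  convert h using 3 with t
  · rw [mul_comm]
    congr 2 <;> ring
  · ring_nf

lemma integrable_gaussian_mul_exp (c : ℂ) (x : ℝ) :
    Integrable fun t : ℝ => ((rexp (-t ^ 2) : ℝ) : ℂ) *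
      (c * Complex.exp (((t * x : ℝ) : ℂ) * Complex.I)) := by
  have hg : Integrable fun t : ℝ => ((rexp (-t ^ 2) : ℝ) : ℂ) := by
    simpa using (integrable_exp_neg_mul_sq (b := 1) one_pos).ofReal (𝕜 := ℂ)
  refine hg.mul_bdd (c := ‖c‖) (by fun_prop) (Filter.Eventually.of_forall fun t => ?_)
  rw [norm_mul, Complex.norm_exp_ofReal_mul_I, mul_one]

lemma exp_neg_sq_div_four_le {x : ℝ} {m : ℤ} (hm : ⌊x⌋ = m) :
    rexp (-x ^ 2 / 4) ≤ 8 * (1 / (1 + (m : ℝ) ^ 2)) := by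
  have h1 : (m : ℝ) ≤ x := hm ▸ Int.floor_le x
  have h2 : x < m + 1 := hm ▸ Int.lt_floor_add_one x
  have h3 : 1 + (m : ℝ) ^ 2 ≤ 8 * (1 + x ^ 2 / 4) := by nlinarith [sq_nonneg (2 * x - m)]
  have h4 : 1 + x ^ 2 / 4 ≤ rexp (x ^ 2 / 4) := by linarith [Real.add_one_le_exp (x ^ 2 / 4)]
  rw [neg_div, Real.exp_neg, mul_one_div, inv_eq_one_div, div_le_div_iff₀ (by positivity)
    (by positivity)]
  linarith

lemma summable_one_div_one_add_int_sq : Summable fun m : ℤ => 1 / (1 + (m : ℝ) ^ 2) := by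
  refine (Real.summable_one_div_int_pow.2 one_lt_two).of_norm_bounded_eventually ?_
  rw [Filter.eventually_cofinite]
  refine (Set.finite_singleton (0 : ℤ)).subset fun m hm => ?_
  by_contra h0
  have : (0 : ℝ) < (m : ℝ) ^ 2 := by
    have : (m : ℝ) ≠ 0 := by exact_mod_cast h0
    positivity
  refine hm ?_
  rw [Real.norm_of_nonneg (by positivity)]
  gcongr
  linarith

lemma sum_exp_neg_sq_div_four_le {ι : Type*} (S : Finset ι) (μ : ι → ℝ) (M : ℕ)
    (hM : ∀ y : ℝ, (S.filter fun j => y ≤ μ j ∧ μ j < y + 1).card ≤ M) (x : ℝ) :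
    ∑ k ∈ S, rexp (-(μ k - x) ^ 2 / 4) ≤ 8 * M * ∑' m : ℤ, 1 / (1 + (m : ℝ) ^ 2) := by
  classical
  rw [← Finset.sum_fiberwise_of_maps_to (t := S.image fun k => ⌊μ k - x⌋)
    (g := fun k => ⌊μ k - x⌋) fun k hk => Finset.mem_image_of_mem _ hk]
  calc _ ≤ ∑ m ∈ S.image fun k => ⌊μ k - x⌋, 8 * (M : ℝ) * (1 / (1 + (m : ℝ) ^ 2)) := by
        refine Finset.sum_le_sum fun m _ => ?_
        refine (Finset.sum_le_card_nsmul _ _ (8 * (1 / (1 + (m : ℝ) ^ 2))) fun k hk =>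
          exp_neg_sq_div_four_le (Finset.mem_filter.1 hk).2).trans ?_
        have hsub : (S.filter fun k => ⌊μ k - x⌋ = m).card ≤ M := by
          refine (Finset.card_le_card fun k hk => ?_).trans (hM (x + m))
          rw [Finset.mem_filter] at hk ⊢
          obtain ⟨h1, h2⟩ := Int.floor_eq_iff.1 hk.2
          exact ⟨hk.1, by linarith, by linarith⟩
        rw [nsmul_eq_mul, mul_left_comm, mul_assoc]
        gcongr
    _ = 8 * (M : ℝ) * ∑ m ∈ S.image fun k => ⌊μ k - x⌋, 1 / (1 + (m : ℝ) ^ 2) := by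
        rw [Finset.mul_sum]
    _ ≤ _ := by
        gcongr
        exact summable_one_div_one_add_int_sq.sum_le_tsum _ fun _ _ => by positivity

/-- Schur's test for a symmetric nonnegative kernel. -/
lemma sum_sum_mul_mul_le {ι : Type*} (S : Finset ι) (b : ι → ℝ) (G : ι → ι → ℝ) (K : ℝ)
    (hG : ∀ j k, 0 ≤ G j k) (hsymm : ∀ j k, G j k = G k j)
    (hK : ∀ j ∈ S, ∑ k ∈ S, G j k ≤ K) :
    ∑ j ∈ S, ∑ k ∈ S, b j * b k * G j k ≤ K * ∑ j ∈ S, b j ^ 2 := by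
  have hrow : ∑ j ∈ S, ∑ k ∈ S, b j ^ 2 * G j k ≤ K * ∑ j ∈ S, b j ^ 2 := by
    rw [Finset.mul_sum]
    refine Finset.sum_le_sum fun j hj => ?_
    rw [← Finset.mul_sum, mul_comm]
    exact mul_le_mul_of_nonneg_right (hK j hj) (sq_nonneg _)
  have hcol : ∑ j ∈ S, ∑ k ∈ S, b k ^ 2 * G j k = ∑ j ∈ S, ∑ k ∈ S, b j ^ 2 * G j k := by
    rw [Finset.sum_comm]
    simp_rw [fun j k => hsymm k j]
  have hamgm : ∑ j ∈ S, ∑ k ∈ S, b j * b k * G j k ≤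
      (∑ j ∈ S, ∑ k ∈ S, b j ^ 2 * G j k + ∑ j ∈ S, ∑ k ∈ S, b k ^ 2 * G j k) / 2 := by
    simp_rw [← Finset.sum_add_distrib, Finset.sum_div]
    refine Finset.sum_le_sum fun j _ => Finset.sum_le_sum fun k _ => ?_
    nlinarith [mul_nonneg (sq_nonneg (b j - b k)) (hG j k)]
  linarith

lemma integral_gaussian_mul_norm_sq_le {ι : Type*} (S : Finset ι) (c : ι → ℂ) (μ : ι → ℝ) (K : ℝ)
    (hK : ∀ j ∈ S, ∑ k ∈ S, rexp (-(μ k - μ j) ^ 2 / 4) ≤ K) :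
    Integrable (fun t : ℝ => rexp (-t ^ 2) *
      ‖∑ j ∈ S, c j * Complex.exp (((t * μ j : ℝ) : ℂ) * Complex.I)‖ ^ 2) ∧
    ∫ t : ℝ, rexp (-t ^ 2) *
      ‖∑ j ∈ S, c j * Complex.exp (((t * μ j : ℝ) : ℂ) * Complex.I)‖ ^ 2 ≤
        √π * K * ∑ j ∈ S, ‖c j‖ ^ 2 := by
  have hexpand : ∀ t : ℝ, ((rexp (-t ^ 2) *
      ‖∑ j ∈ S, c j * Complex.exp (((t * μ j : ℝ) : ℂ) * Complex.I)‖ ^ 2 : ℝ) : ℂ) =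
      ∑ j ∈ S, ∑ k ∈ S, ((rexp (-t ^ 2) : ℝ) : ℂ) * (c j * (starRingEnd ℂ) (c k) *
        Complex.exp (((t * (μ j - μ k) : ℝ) : ℂ) * Complex.I)) := fun t => by
    rw [Complex.ofReal_mul, ofReal_norm_sq_sum_mul_exp]
    simp_rw [Finset.mul_sum, mul_sub]
  have hintegrable := fun j k =>
    integrable_gaussian_mul_exp (c j * (starRingEnd ℂ) (c k)) (μ j - μ k)
  have hint : Integrable fun t : ℝ => ((rexp (-t ^ 2) *
      ‖∑ j ∈ S, c j * Complex.exp (((t * μ j : ℝ) : ℂ) * Complex.I)‖ ^ 2 : ℝ) : ℂ) := by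
    simp_rw [hexpand]
    exact integrable_finsetSum _ fun j _ => integrable_finsetSum _ fun k _ => hintegrable j k
  refine ⟨by simpa only [RCLike.re_to_complex, Complex.ofReal_re] using hint.re, ?_⟩
  have heval : ((∫ t : ℝ, rexp (-t ^ 2) *
      ‖∑ j ∈ S, c j * Complex.exp (((t * μ j : ℝ) : ℂ) * Complex.I)‖ ^ 2 : ℝ) : ℂ) =
      ∑ j ∈ S, ∑ k ∈ S, c j * (starRingEnd ℂ) (c k) *
        ((√π * rexp (-(μ j - μ k) ^ 2 / 4) : ℝ) : ℂ) := by
    rw [← integral_complex_ofReal]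
    simp_rw [hexpand]
    rw [integral_finsetSum _ fun j _ => integrable_finsetSum _ fun k _ => hintegrable j k]
    refine Finset.sum_congr rfl fun j _ => ?_
    rw [integral_finsetSum _ fun k _ => hintegrable j k]
    refine Finset.sum_congr rfl fun k _ => ?_
    simp_rw [mul_left_comm _ (c j * (starRingEnd ℂ) (c k))]
    rw [integral_const_mul, integral_gaussian_mul_exp]
  have hschur := sum_sum_mul_mul_le S (fun j => ‖c j‖)
    (fun j k => √π * rexp (-(μ j - μ k) ^ 2 / 4)) (√π * K) (fun _ _ => by positivity)
    (fun j k => by rw [← neg_sub (μ k), neg_sq]) fun j hj => by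
      rw [← Finset.mul_sum]
      refine mul_le_mul_of_nonneg_left (le_of_eq_of_le ?_ (hK j hj)) (Real.sqrt_nonneg _)
      exact Finset.sum_congr rfl fun k _ => by rw [← neg_sub (μ k), neg_sq]
  refine (Complex.re_le_norm _).trans' (Complex.ofReal_re _).ge |>.trans ?_
  rw [heval]
  refine le_trans ?_ hschur
  refine (norm_sum_le _ _).trans (Finset.sum_le_sum fun j _ => ?_)
  refine (norm_sum_le _ _).trans (Finset.sum_le_sum fun k _ => ?_)
  rw [norm_mul, norm_mul, RCLike.norm_conj, Complex.norm_of_nonneg (by positivity)]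

/-- A large sieve inequality: a trigonometric sum with at most `M` frequencies in each unit interval
is bounded in mean square on `[0, 1]`. -/
lemma integral_norm_sq_le_of_card_le {ι : Type*} (S : Finset ι) (c : ι → ℂ) (μ : ι → ℝ) (M : ℕ)
    (hM : ∀ y : ℝ, (S.filter fun j => y ≤ μ j ∧ μ j < y + 1).card ≤ M) :
    ∫ t in (0 : ℝ)..1, ‖∑ j ∈ S, c j * Complex.exp (((t * μ j : ℝ) : ℂ) * Complex.I)‖ ^ 2 ≤
      rexp 1 * (√π * (8 * M * ∑' m : ℤ, 1 / (1 + (m : ℝ) ^ 2)) * ∑ j ∈ S, ‖c j‖ ^ 2) := by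
  obtain ⟨hint, hle⟩ := integral_gaussian_mul_norm_sq_le S c μ _
    fun j _ => sum_exp_neg_sq_div_four_le S μ M hM (μ j)
  refine le_trans ?_ (mul_le_mul_of_nonneg_left hle (Real.exp_pos 1).le)
  rw [← integral_const_mul]
  refine le_trans ?_ (setIntegral_le_integral (s := Set.Ioc 0 1) (hint.const_mul _)
    (Filter.Eventually.of_forall fun t => by simp only [Pi.zero_apply]; positivity))
  rw [← intervalIntegral.integral_of_le zero_le_one]
  refine intervalIntegral.integral_mono_on zero_le_one
    (Continuous.intervalIntegrable (by fun_prop) _ _)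
    (Continuous.intervalIntegrable (by fun_prop) _ _) fun t ht => ?_
  rw [← mul_assoc, ← Real.exp_add]
  refine le_mul_of_one_le_left (sq_nonneg _) (Real.one_le_exp ?_)
  nlinarith [ht.1, ht.2]

lemma sub_le_of_cos_sub_cos_le {φ₁ φ₂ r : ℝ} (h₁ : 0 ≤ φ₁) (h₂ : φ₂ ≤ π) (hr : 0 ≤ r)
    (h : cos φ₁ - cos φ₂ ≤ r ^ 2) : φ₂ - φ₁ ≤ 3 * r := by
  rcases le_total φ₂ φ₁ with hle | hle
  · linarith
  set δ := (φ₂ - φ₁) / 2 with hδ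
  have hδ0 : 0 ≤ δ := by linarith
  have hsin : sin δ ≤ sin ((φ₁ + φ₂) / 2) := by
    have e := Real.sin_sub_sin ((φ₁ + φ₂) / 2) δ
    rw [show ((φ₁ + φ₂) / 2 - δ) / 2 = φ₁ / 2 by rw [hδ]; ring,
      show ((φ₁ + φ₂) / 2 + δ) / 2 = φ₂ / 2 by rw [hδ]; ring] at e
    have := Real.sin_nonneg_of_nonneg_of_le_pi (x := φ₁ / 2) (by linarith) (by linarith)
    have := Real.cos_nonneg_of_neg_pi_div_two_le_of_le (x := φ₂ / 2) (by linarith) (by linarith)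
    have : 0 ≤ 2 * sin (φ₁ / 2) * cos (φ₂ / 2) := by positivity
    linarith
  have hjordan := Real.mul_le_sin hδ0 (by linarith)
  rw [Real.cos_sub_cos, show (φ₁ - φ₂) / 2 = -δ by rw [hδ]; ring, Real.sin_neg] at h
  have hnn : 0 ≤ 2 / π * δ := by positivity
  have hsq : 2 * (2 / π * δ) ^ 2 ≤ r ^ 2 := by nlinarith
  have hpi : δ = π / 2 * (2 / π * δ) := by field_simp
  have : (2 * δ) ^ 2 ≤ (3 * r) ^ 2 := by
    have hpi2 : π ^ 2 ≤ 18 := by nlinarith [Real.pi_lt_four, Real.pi_lt_d2, Real.pi_pos]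
    calc (2 * δ) ^ 2 = π ^ 2 * (2 / π * δ) ^ 2 := by rw [hpi]; field_simp
      _ ≤ 18 * (2 / π * δ) ^ 2 := by gcongr
      _ ≤ (3 * r) ^ 2 := by linarith
  have := le_of_sq_le_sq this (by positivity)
  linarith

lemma card_le_of_polar {B : ℕ} {lam r : ℝ}
    (hB : ∀ t₀ : ℝ,
      ({ℓ : ℤ × ℤ | ∃ t ∈ Set.Icc t₀ (t₀ + r),
          (ℓ.1 : ℝ) = lam * Real.cos t ∧ (ℓ.2 : ℝ) = lam * Real.sin t}).Finite ∧
      ({ℓ : ℤ × ℤ | ∃ t ∈ Set.Icc t₀ (t₀ + r),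
          (ℓ.1 : ℝ) = lam * Real.cos t ∧ (ℓ.2 : ℝ) = lam * Real.sin t}).ncard ≤ B)
    (T : Finset (ℤ × ℤ)) (ψ : ℤ × ℤ → ℝ)
    (hψ : ∀ ℓ ∈ T, (ℓ.1 : ℝ) = lam * cos (ψ ℓ) ∧ (ℓ.2 : ℝ) = lam * sin (ψ ℓ))
    (hdiam : ∀ ℓ ∈ T, ∀ ℓ' ∈ T, ψ ℓ' - ψ ℓ ≤ 3 * r) : T.card ≤ 3 * B := by
  rcases T.eq_empty_or_nonempty with rfl | hT
  · simp
  obtain ⟨ℓ₀, hℓ₀, hmin⟩ := T.exists_min_image ψ hT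
  set A : ℝ → Set (ℤ × ℤ) := fun t₀ => {ℓ : ℤ × ℤ | ∃ t ∈ Set.Icc t₀ (t₀ + r),
    (ℓ.1 : ℝ) = lam * Real.cos t ∧ (ℓ.2 : ℝ) = lam * Real.sin t}
  have hsub : (T : Set (ℤ × ℤ)) ⊆ A (ψ ℓ₀) ∪ A (ψ ℓ₀ + r) ∪ A (ψ ℓ₀ + 2 * r) := by
    intro ℓ hℓ
    have h1 := hmin ℓ hℓ
    have h2 := hdiam ℓ₀ hℓ₀ ℓ hℓ
    rcases le_total (ψ ℓ) (ψ ℓ₀ + r) with h | h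
    · exact Or.inl (Or.inl ⟨ψ ℓ, ⟨h1, h⟩, hψ ℓ hℓ⟩)
    rcases le_total (ψ ℓ) (ψ ℓ₀ + 2 * r) with h' | h'
    · exact Or.inl (Or.inr ⟨ψ ℓ, ⟨h, by linarith⟩, hψ ℓ hℓ⟩)
    · exact Or.inr ⟨ψ ℓ, ⟨h', by linarith⟩, hψ ℓ hℓ⟩
  rw [← Set.ncard_coe_finset]
  have hfin := (((hB (ψ ℓ₀)).1.union (hB (ψ ℓ₀ + r)).1).union (hB (ψ ℓ₀ + 2 * r)).1)
  refine (Set.ncard_le_ncard hsub hfin).trans ?_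
  refine (Set.ncard_union_le _ _).trans ?_
  have h1 := Set.ncard_union_le (A (ψ ℓ₀)) (A (ψ ℓ₀ + r))
  have h2 := (hB (ψ ℓ₀)).2
  have h3 := (hB (ψ ℓ₀ + r)).2
  have h4 := (hB (ψ ℓ₀ + 2 * r)).2
  change (A (ψ ℓ₀)).ncard ≤ B at h2
  change (A (ψ ℓ₀ + r)).ncard ≤ B at h3
  change (A (ψ ℓ₀ + 2 * r)).ncard ≤ B at h4
  omega

/-- Lattice points on a circle lying in a strip of unit width: the strip meets the circle in two
arcs of aperture `O(λ^{-1/2})`. -/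
lemma card_strip_le {B : ℕ} {lam r : ℝ} (hlam : 0 < lam) (hr : 0 ≤ r) (hrlam : lam * r ^ 2 = 1)
    (hB : ∀ t₀ : ℝ,
      ({ℓ : ℤ × ℤ | ∃ t ∈ Set.Icc t₀ (t₀ + r),
          (ℓ.1 : ℝ) = lam * Real.cos t ∧ (ℓ.2 : ℝ) = lam * Real.sin t}).Finite ∧
      ({ℓ : ℤ × ℤ | ∃ t ∈ Set.Icc t₀ (t₀ + r),
          (ℓ.1 : ℝ) = lam * Real.cos t ∧ (ℓ.2 : ℝ) = lam * Real.sin t}).ncard ≤ B)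
    (S : Finset (ℤ × ℤ)) (hS : ∀ ℓ ∈ S, ((ℓ.1 : ℝ)) ^ 2 + ((ℓ.2 : ℝ)) ^ 2 = lam ^ 2)
    (v : ℝ × ℝ) (hv : v.1 ^ 2 + v.2 ^ 2 = 1) (y : ℝ) :
    (S.filter fun ℓ => y ≤ v.1 * ℓ.1 + v.2 * ℓ.2 ∧ v.1 * ℓ.1 + v.2 * ℓ.2 < y + 1).card ≤
      6 * B := by
  set T := S.filter fun ℓ => y ≤ v.1 * ℓ.1 + v.2 * ℓ.2 ∧ v.1 * ℓ.1 + v.2 * ℓ.2 < y + 1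
  set w : ℂ := ⟨v.1, v.2⟩
  set z : ℤ × ℤ → ℂ := fun ℓ => ⟨v.1 * ℓ.1 + v.2 * ℓ.2, v.1 * ℓ.2 - v.2 * ℓ.1⟩
  have hwn : ‖w‖ = 1 := by
    rw [Complex.norm_def, Complex.normSq_mk, ← sq, ← sq, hv, Real.sqrt_one]
  have hcos : cos w.arg = v.1 := by
    rw [← one_mul (cos _), ← hwn, Complex.norm_mul_cos_arg]
  have hsin : sin w.arg = v.2 := by
    rw [← one_mul (sin _), ← hwn, Complex.norm_mul_sin_arg]
  have hzn : ∀ ℓ ∈ S, ‖z ℓ‖ = lam := fun ℓ hℓ => by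
    rw [Complex.norm_def, Complex.normSq_mk, Real.sqrt_eq_iff_eq_sq _ hlam.le, ← hS ℓ hℓ]
    · linear_combination ((ℓ.1 : ℝ) ^ 2 + (ℓ.2 : ℝ) ^ 2) * hv
    · nlinarith [sq_nonneg (v.1 * ℓ.1 + v.2 * ℓ.2), sq_nonneg (v.1 * ℓ.2 - v.2 * ℓ.1)]
  have hzcos : ∀ ℓ ∈ S, lam * cos (z ℓ).arg = v.1 * ℓ.1 + v.2 * ℓ.2 := fun ℓ hℓ => by
    rw [← hzn ℓ hℓ, Complex.norm_mul_cos_arg]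
  have hzsin : ∀ ℓ ∈ S, lam * sin (z ℓ).arg = v.1 * ℓ.2 - v.2 * ℓ.1 := fun ℓ hℓ => by
    rw [← hzn ℓ hℓ, Complex.norm_mul_sin_arg]
  have hpolar : ∀ ℓ ∈ T, (ℓ.1 : ℝ) = lam * cos (w.arg + (z ℓ).arg) ∧
      (ℓ.2 : ℝ) = lam * sin (w.arg + (z ℓ).arg) := fun ℓ hℓ => by
    have hℓS := (Finset.mem_filter.1 hℓ).1
    rw [Real.cos_add, Real.sin_add, hcos, hsin]
    constructor
    · linear_combination (-(ℓ.1 : ℝ)) * hv - v.1 * hzcos ℓ hℓS + v.2 * hzsin ℓ hℓS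
    · linear_combination (-(ℓ.2 : ℝ)) * hv - v.2 * hzcos ℓ hℓS - v.1 * hzsin ℓ hℓS
  have hclose : ∀ ℓ ∈ T, ∀ ℓ' ∈ T, cos (z ℓ).arg - cos (z ℓ').arg ≤ r ^ 2 := by
    intro ℓ hℓ ℓ' hℓ'
    obtain ⟨hℓS, -, h1⟩ := Finset.mem_filter.1 hℓ
    obtain ⟨hℓS', h2, -⟩ := Finset.mem_filter.1 hℓ'
    refine le_of_mul_le_mul_left ?_ hlam
    rw [mul_sub, hzcos ℓ hℓS, hzcos ℓ' hℓS', hrlam]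
    linarith
  have hpos : (T.filter fun ℓ => 0 ≤ (z ℓ).arg).card ≤ 3 * B := by
    refine card_le_of_polar hB _ (fun ℓ => w.arg + (z ℓ).arg)
      (fun ℓ hℓ => hpolar ℓ (Finset.mem_filter.1 hℓ).1) fun ℓ hℓ ℓ' hℓ' => ?_
    rw [Finset.mem_filter] at hℓ hℓ'
    have := sub_le_of_cos_sub_cos_le hℓ.2 (Complex.arg_le_pi (z ℓ')) hr
      (hclose ℓ hℓ.1 ℓ' hℓ'.1)
    linarith
  have hneg : (T.filter fun ℓ => ¬ 0 ≤ (z ℓ).arg).card ≤ 3 * B := by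
    refine card_le_of_polar hB _ (fun ℓ => w.arg + (z ℓ).arg)
      (fun ℓ hℓ => hpolar ℓ (Finset.mem_filter.1 hℓ).1) fun ℓ hℓ ℓ' hℓ' => ?_
    rw [Finset.mem_filter] at hℓ hℓ'
    have := sub_le_of_cos_sub_cos_le (φ₁ := -(z ℓ').arg) (φ₂ := -(z ℓ).arg) (r := r)
      (by linarith [hℓ'.2]) (by linarith [Complex.neg_pi_lt_arg (z ℓ)]) hr
      (by rw [Real.cos_neg, Real.cos_neg]; exact hclose ℓ' hℓ'.1 ℓ hℓ.1)
    linarith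
  rw [← Finset.card_filter_add_card_filter_not (s := T) fun ℓ => 0 ≤ (z ℓ).arg]
  omega

lemma mul_rpow_neg_half_sq {lam : ℝ} (hlam : 0 < lam) :
    lam * (lam ^ (-(1 / 2) : ℝ)) ^ 2 = 1 := by
  rw [← Real.rpow_natCast, ← Real.rpow_mul hlam.le]
  norm_num
  rw [Real.rpow_neg_one, mul_inv_cancel₀ hlam.ne']

lemma one_le_of_sq_add_sq_eq {lam : ℝ} (hlam : 0 < lam) {ℓ : ℤ × ℤ}
    (h : (ℓ.1 : ℝ) ^ 2 + (ℓ.2 : ℝ) ^ 2 = lam ^ 2) : 1 ≤ lam := by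
  have hpos : (0 : ℝ) < (ℓ.1 : ℝ) ^ 2 + (ℓ.2 : ℝ) ^ 2 := h ▸ by positivity
  have hint : 0 < ℓ.1 ^ 2 + ℓ.2 ^ 2 := by exact_mod_cast hpos
  have hone : (1 : ℝ) ≤ (ℓ.1 : ℝ) ^ 2 + (ℓ.2 : ℝ) ^ 2 := by exact_mod_cast hint
  nlinarith

lemma finite_lattice_circle (lam : ℝ) :
    {ℓ : ℤ × ℤ | (ℓ.1 : ℝ) ^ 2 + (ℓ.2 : ℝ) ^ 2 = lam ^ 2}.Finite := by
  have hbound : ∀ n : ℤ, (n : ℝ) ^ 2 ≤ lam ^ 2 → n ∈ Set.Icc (-⌈|lam|⌉) ⌈|lam|⌉ := fun n hn => by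
    have h := abs_le.1 (sq_le_sq.1 hn)
    have hc := Int.le_ceil |lam|
    have h1 : -(⌈|lam|⌉ : ℝ) ≤ n := by linarith [h.1]
    have h2 : (n : ℝ) ≤ ⌈|lam|⌉ := by linarith [h.2]
    exact ⟨by exact_mod_cast h1, by exact_mod_cast h2⟩
  refine ((Set.finite_Icc (-⌈|lam|⌉) ⌈|lam|⌉).prod (Set.finite_Icc (-⌈|lam|⌉) ⌈|lam|⌉)).subset
    fun ℓ hℓ => ?_
  have hℓ' : (ℓ.1 : ℝ) ^ 2 + (ℓ.2 : ℝ) ^ 2 = lam ^ 2 := hℓ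
  exact ⟨hbound _ (by nlinarith [sq_nonneg (ℓ.2 : ℝ)]),
    hbound _ (by nlinarith [sq_nonneg (ℓ.1 : ℝ)])⟩

/-- Unit exponentials whose frequencies are within `1 / 2` of each other do not cancel on
`[0, 1]`. -/
lemma sq_card_le_integral_norm_sq {ι : Type*} (S : Finset ι) (μ : ι → ℝ) (lam : ℝ)
    (hμ : ∀ j ∈ S, |lam - μ j| ≤ 1 / 2) :
    (S.card : ℝ) ^ 2 / 4 ≤
      ∫ t in (0 : ℝ)..1, ‖∑ j ∈ S, Complex.exp (((t * μ j : ℝ) : ℂ) * Complex.I)‖ ^ 2 := by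
  have hpt : ∀ t ∈ Set.Icc (0 : ℝ) 1, (S.card : ℝ) ^ 2 / 4 ≤
      ‖∑ j ∈ S, Complex.exp (((t * μ j : ℝ) : ℂ) * Complex.I)‖ ^ 2 := by
    intro t ht
    have hre : (S.card : ℝ) / 2 ≤
        ‖∑ j ∈ S, Complex.exp (((t * μ j : ℝ) : ℂ) * Complex.I)‖ := by
      calc (S.card : ℝ) / 2 = ∑ j ∈ S, (1 / 2 : ℝ) := by simp [div_eq_mul_inv]
        _ ≤ ∑ j ∈ S, cos (t * μ j - t * lam) := by
            refine Finset.sum_le_sum fun j hj => le_trans ?_ Real.one_sub_sq_div_two_le_cos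
            have h : |t * μ j - t * lam| ≤ 1 / 2 := by
              rw [← mul_sub, abs_mul, abs_of_nonneg ht.1, abs_sub_comm]
              nlinarith [hμ j hj, ht.1, ht.2, abs_nonneg (lam - μ j)]
            have h2 := abs_le.1 h
            nlinarith
        _ = (Complex.exp (((-(t * lam) : ℝ) : ℂ) * Complex.I) *
              ∑ j ∈ S, Complex.exp (((t * μ j : ℝ) : ℂ) * Complex.I)).re := by
            rw [Finset.mul_sum, Complex.re_sum]
            refine Finset.sum_congr rfl fun j _ => ?_
            rw [← Complex.exp_add, ← add_mul, ← Complex.ofReal_add, Complex.exp_ofReal_mul_I_re,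
              neg_add_eq_sub]
        _ ≤ _ := by
            refine (Complex.re_le_norm _).trans ?_
            rw [norm_mul, Complex.norm_exp_ofReal_mul_I, one_mul]
    calc (S.card : ℝ) ^ 2 / 4 = ((S.card : ℝ) / 2) ^ 2 := by ring
      _ ≤ _ := by gcongr
  have h := intervalIntegral.integral_mono_on zero_le_one intervalIntegrable_const
    (Continuous.intervalIntegrable (by fun_prop) _ _) hpt (μ := volume)
  simpa using h

/-- Sarnak's observation: uniform `O(1)` geodesic restriction bounds for toral
eigenfunctions `f(x) = Σ_{ℓ ∈ ℤ², |ℓ| = λ} a_ℓ e^{i⟨x,ℓ⟩}` are equivalent to a uniform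
bound on the number of lattice points of `ℤ²` on arcs of the circle of radius `λ` of
angular aperture `λ^{-1/2}`. -/
theorem sarnak_equivalence :
    (∃ C : ℝ, 0 < C ∧
      ∀ lam : ℝ, 0 < lam →
      ∀ S : Finset (ℤ × ℤ), (∀ ℓ ∈ S, ((ℓ.1 : ℝ)) ^ 2 + ((ℓ.2 : ℝ)) ^ 2 = lam ^ 2) →
      ∀ a : ℤ × ℤ → ℂ, ∀ x₀ v : ℝ × ℝ, v.1 ^ 2 + v.2 ^ 2 = 1 →
        (∫ t in (0 : ℝ)..1,
            ‖∑ ℓ ∈ S, a ℓ *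
              Complex.exp ((((x₀.1 + t * v.1) * ℓ.1 + (x₀.2 + t * v.2) * ℓ.2 : ℝ) : ℂ) *
                Complex.I)‖ ^ 2)
          ≤ C * ∫ x in (Set.Icc (0 : ℝ) (2 * π)) ×ˢ (Set.Icc (0 : ℝ) (2 * π)),
              ‖∑ ℓ ∈ S, a ℓ *
                Complex.exp (((x.1 * ℓ.1 + x.2 * ℓ.2 : ℝ) : ℂ) * Complex.I)‖ ^ 2)
    ↔
    (∃ B : ℕ, ∀ lam : ℝ, 1 ≤ lam → ∀ t₀ : ℝ,
      ({ℓ : ℤ × ℤ | ∃ t ∈ Set.Icc t₀ (t₀ + lam ^ (-(1 / 2) : ℝ)),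
          (ℓ.1 : ℝ) = lam * Real.cos t ∧ (ℓ.2 : ℝ) = lam * Real.sin t}).Finite ∧
      ({ℓ : ℤ × ℤ | ∃ t ∈ Set.Icc t₀ (t₀ + lam ^ (-(1 / 2) : ℝ)),
          (ℓ.1 : ℝ) = lam * Real.cos t ∧ (ℓ.2 : ℝ) = lam * Real.sin t}).ncard ≤ B) := by
  simp_rw [integral_torus_norm_sq]
  constructor
  · rintro ⟨C, hC0, hC⟩
    refine ⟨⌈16 * π ^ 2 * C⌉₊, fun lam hlam1 t₀ => ?_⟩
    have hlam : 0 < lam := by linarith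
    set r := lam ^ (-(1 / 2) : ℝ)
    have hrlam : lam * r ^ 2 = 1 := mul_rpow_neg_half_sq hlam
    set A := {ℓ : ℤ × ℤ | ∃ t ∈ Set.Icc t₀ (t₀ + r),
      (ℓ.1 : ℝ) = lam * Real.cos t ∧ (ℓ.2 : ℝ) = lam * Real.sin t}
    have hcirc : ∀ ℓ ∈ A, (ℓ.1 : ℝ) ^ 2 + (ℓ.2 : ℝ) ^ 2 = lam ^ 2 := by
      rintro ℓ ⟨t, -, h1, h2⟩
      rw [h1, h2]
      linear_combination lam ^ 2 * Real.cos_sq_add_sin_sq t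
    have hfin : A.Finite := (finite_lattice_circle lam).subset hcirc
    refine ⟨hfin, ?_⟩
    set S := hfin.toFinset
    have hmem : ∀ ℓ ∈ S, ℓ ∈ A := fun ℓ hℓ => hfin.mem_toFinset.1 hℓ
    have hradial : ∀ ℓ ∈ S, |lam - (cos t₀ * ℓ.1 + sin t₀ * ℓ.2)| ≤ 1 / 2 := by
      intro ℓ hℓ
      obtain ⟨t, ⟨ht1, ht2⟩, h1, h2⟩ := hmem ℓ hℓ
      have hcos : cos t₀ * ℓ.1 + sin t₀ * ℓ.2 = lam * cos (t - t₀) := by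
        rw [h1, h2, Real.cos_sub]
        ring
      have hsq : (t - t₀) ^ 2 ≤ r ^ 2 := pow_le_pow_left₀ (by linarith) (by linarith) 2
      rw [hcos, abs_of_nonneg (by nlinarith [Real.cos_le_one (t - t₀)])]
      nlinarith [Real.one_sub_sq_div_two_le_cos (x := t - t₀)]
    have hlower := sq_card_le_integral_norm_sq S _ lam hradial
    have hupper := hC lam hlam S (fun ℓ hℓ => hcirc ℓ (hmem ℓ hℓ)) (fun _ => 1) (0, 0)
      (cos t₀, sin t₀) (Real.cos_sq_add_sin_sq t₀)
    simp only [zero_add, one_mul, norm_one, one_pow, Finset.sum_const, nsmul_eq_mul, mul_one,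
      mul_assoc, ← mul_add] at hupper hlower
    have hle := hlower.trans hupper
    rw [Set.ncard_eq_toFinset_card A hfin]
    refine Nat.cast_le.1 (le_trans ?_ (Nat.le_ceil (16 * π ^ 2 * C)) : (S.card : ℝ) ≤ _)
    rcases S.eq_empty_or_nonempty with h0 | hne
    · simp only [h0, Finset.card_empty, Nat.cast_zero]
      positivity
    · have hpos : (0 : ℝ) < S.card := by exact_mod_cast hne.card_pos
      refine le_of_mul_le_mul_right ?_ hpos
      linarith
  · rintro ⟨B, hB⟩
    set K := rexp 1 * (√π * (8 * (6 * B : ℕ) * ∑' m : ℤ, 1 / (1 + (m : ℝ) ^ 2))) with hK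
    have hK0 : 0 ≤ K := by
      have : 0 ≤ ∑' m : ℤ, 1 / (1 + (m : ℝ) ^ 2) := tsum_nonneg fun _ => by positivity
      positivity
    refine ⟨(K + 1) / (2 * π) ^ 2, by positivity, fun lam hlam S hS a x₀ v hv => ?_⟩
    have hconst : ∀ s : ℝ, (K + 1) / (2 * π) ^ 2 * ((2 * π) ^ 2 * s) = (K + 1) * s := fun s => by
      field_simp
    rw [hconst]
    rcases S.eq_empty_or_nonempty with rfl | ⟨ℓ₀, hℓ₀⟩
    · simp
    have hlam1 := one_le_of_sq_add_sq_eq hlam (hS ℓ₀ hℓ₀)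
    have hsieve := integral_norm_sq_le_of_card_le S
      (fun ℓ => a ℓ * Complex.exp (((x₀.1 * ℓ.1 + x₀.2 * ℓ.2 : ℝ) : ℂ) * Complex.I))
      (fun ℓ => v.1 * ℓ.1 + v.2 * ℓ.2) (6 * B)
      (card_strip_le hlam (by positivity) (mul_rpow_neg_half_sq hlam) (hB lam hlam1) S hS v hv)
    have hexp : ∀ (t : ℝ) (ℓ : ℤ × ℤ),
        a ℓ * Complex.exp (((x₀.1 * ℓ.1 + x₀.2 * ℓ.2 : ℝ) : ℂ) * Complex.I) *
          Complex.exp (((t * (v.1 * ℓ.1 + v.2 * ℓ.2) : ℝ) : ℂ) * Complex.I) =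
        a ℓ * Complex.exp ((((x₀.1 + t * v.1) * ℓ.1 + (x₀.2 + t * v.2) * ℓ.2 : ℝ) : ℂ) *
          Complex.I) := fun t ℓ => by
      rw [mul_assoc, ← Complex.exp_add]
      congr 2
      push_cast
      ring
    simp_rw [hexp, norm_mul, Complex.norm_exp_ofReal_mul_I, mul_one] at hsieve
    refine hsieve.trans ?_
    have hsum : 0 ≤ ∑ ℓ ∈ S, ‖a ℓ‖ ^ 2 := Finset.sum_nonneg fun _ _ => sq_nonneg _
    linear_combination hsum

end
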